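/- arXiv:math/0607394 — 2 statements merged into one kernel-verified Lean document; each statement's English description precedes it below -/
import Mathlib

section
/- Let T be a compactly generated triangulated category and U a left aisle in the subcategory T_c of compact objects. Then the smallest strictly full subcategory T_{≤0} of T containing U and stable under arbitrary coproducts and under extensions is stable under the suspension functor S, and the inclusion functor T_{≤0} ↪ T admits a right adjoint; hence T_{≤0} is a left aisle on T. (Proposition A.1(a), existence part.) -/
/-!
Setting: `T` is a compactly generated triangulated category with suspension
functor `S = ⟦1⟧` admitting arbitrary (small) coproducts, `U ⊆ T_c` is a left
aisle in the full subcategory `T_c` of compact objects, and `T_{≤0}` is the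
smallest strictly full subcategory of `T` containing `U` and stable under
arbitrary coproducts and under extensions.
-/

namespace CYPaper

open CategoryTheory CategoryTheory.Limits CategoryTheory.Pretriangulated

universe v u

variable (T : Type u) [Category.{v} T] [HasZeroObject T] [Preadditive T]
  [HasShift T ℤ] [∀ n : ℤ, (shiftFunctor T n).Additive]
  [Pretriangulated T] [HasCoproducts.{v} T]

instance : HasColimitsOfShape (Discrete ℕ) T :=
  hasColimitsOfShape_of_equivalence (Discrete.equivalence Equiv.ulift.{v, 0})

/-- An object `C` is compact if `Hom(C, −)` (as an additive functor) commutes with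
arbitrary (small) coproducts. -/
def IsCompactObj (C : T) : Prop :=
  ∀ I : Type v,
    PreservesColimitsOfShape (Discrete I) (preadditiveCoyoneda.obj (Opposite.op C))

/-- The class of compact objects, i.e. the full triangulated subcategory `T_c`. -/
def Compacts : Set T := {C | IsCompactObj T C}

/-- `T` is compactly generated: there is a set `G` of compact objects such that an
object `X` is zero whenever `Hom(S^n G, X) = 0` for all `G ∈ G` and all `n : ℤ`. -/
def CompactlyGenerated : Prop :=
  ∃ G : Set T, Small.{v} ↥G ∧ (∀ C ∈ G, IsCompactObj T C) ∧
    ∀ X : T, (∀ C ∈ G, ∀ n : ℤ, ∀ f : C⟦n⟧ ⟶ X, f = 0) → IsZero X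

/-- A left aisle in the (strictly) full subcategory of `T` with class of objects `A`:
a strictly full additive subcategory stable under the suspension and under
extensions, whose inclusion admits a right adjoint (expressed by the existence of
coreflections). -/
structure LeftAisle (A : Set T) where
  carrier : Set T
  subset : carrier ⊆ A
  iso_closed : ∀ {X Y : T}, (X ≅ Y) → Y ∈ A → X ∈ carrier → Y ∈ carrier
  zero_mem : ∀ X : T, IsZero X → X ∈ A → X ∈ carrier
  sum_mem : ∀ {X Y : T}, X ∈ carrier → Y ∈ carrier →
    ∀ c : BinaryCofan X Y, Nonempty (IsColimit c) → c.pt ∈ A → c.pt ∈ carrier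
  shift_mem : ∀ X ∈ carrier, X⟦(1 : ℤ)⟧ ∈ carrier
  ext_mem : ∀ Tr : Triangle T, Tr ∈ (distTriang T) →
    Tr.obj₁ ∈ carrier → Tr.obj₃ ∈ carrier → Tr.obj₂ ∈ A → Tr.obj₂ ∈ carrier
  coreflect : ∀ X ∈ A, ∃ (U₀ : T) (_ : U₀ ∈ carrier) (ε : U₀ ⟶ X),
    ∀ R ∈ carrier, Function.Bijective fun g : R ⟶ U₀ => g ≫ ε

/-- The smallest strictly full subcategory of `T` containing `U` and stable under
arbitrary (small) coproducts and under extensions. -/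
inductive aisleGen (U : Set T) : T → Prop
  | of (X : T) (hX : X ∈ U) : aisleGen U X
  | iso (X Y : T) (e : X ≅ Y) (hX : aisleGen U X) : aisleGen U Y
  | coprod {I : Type v} (Y : I → T) (hY : ∀ i, aisleGen U (Y i)) : aisleGen U (∐ Y)
  | ext (Tr : Triangle T) (hT : Tr ∈ (distTriang T))
      (h₁ : aisleGen U Tr.obj₁) (h₃ : aisleGen U Tr.obj₃) : aisleGen U Tr.obj₂

/-- `T_{≤0}`. -/
def TLe0 (U : Set T) : Set T := {X | aisleGen T U X}

/-- `T_{≤n} := S^{−n} T_{≤0}`. -/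
def TLe (U : Set T) (n : ℤ) : Set T := {X | X⟦n⟧ ∈ TLe0 T U}

/-- `T_{>n} := (T_{≤n})^⊥`. -/
def TGt (U : Set T) (n : ℤ) : Set T := {Y | ∀ Z ∈ TLe T U n, ∀ f : Z ⟶ Y, f = 0}

/-- A truncation triangle `τ_{≤n} X → X → τ_{>n} X → S (τ_{≤n} X)` of `X` with
respect to the left aisle `T_{≤n}` on `T`. -/
structure TruncTriangle (U : Set T) (n : ℤ) (X : T) where
  low : T
  high : T
  ι : low ⟶ X
  π : X ⟶ high
  δ : high ⟶ low⟦(1 : ℤ)⟧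
  low_mem : low ∈ TLe T U n
  high_mem : high ∈ TGt T U n
  dist : Triangle.mk ι π δ ∈ (distTriang T)

/-- Data computing `H^n X = τ_{≥n} τ_{≤n} X = τ_{>n−1} τ_{≤n} X`: a truncation
triangle `t` of `X` at level `n` together with a truncation triangle `s` of
`τ_{≤n} X = t.low` at level `n − 1`; then `H^n X = s.high`. -/
structure HomologyData (U : Set T) (n : ℤ) (X : T) where
  t : TruncTriangle T U n X
  s : TruncTriangle T U (n - 1) t.low

/-- The morphism `H^n f : H^n X ⟶ H^n Y` induced by `f : X ⟶ Y` on the homology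
objects, encoded by its defining compatibilities. -/
structure HomologyMapData (U : Set T) (n : ℤ) {X Y : T} (f : X ⟶ Y)
    (dX : HomologyData T U n X) (dY : HomologyData T U n Y) where
  g : dX.t.low ⟶ dY.t.low
  hg : g ≫ dY.t.ι = dX.t.ι ≫ f
  h : dX.s.high ⟶ dY.s.high
  hh : dX.s.π ≫ h = g ≫ dY.s.π

/-- A truncation triangle at level `n`, with respect to the left aisle `U`, inside
the subcategory `T_c` of compact objects. -/
structure CTruncTriangle (U : Set T) (n : ℤ) (X : T) where
  low : T
  high : T
  ι : low ⟶ X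
  π : X ⟶ high
  δ : high ⟶ low⟦(1 : ℤ)⟧
  low_mem : low⟦n⟧ ∈ U
  high_compact : IsCompactObj T high
  high_orth : ∀ Z : T, Z⟦n⟧ ∈ U → ∀ f : Z ⟶ high, f = 0
  dist : Triangle.mk ι π δ ∈ (distTriang T)

/-- Data computing the homology `H^n X` with respect to the aisle `U` in `T_c`. -/
structure CHomologyData (U : Set T) (n : ℤ) (X : T) where
  t : CTruncTriangle T U n X
  s : CTruncTriangle T U (n - 1) t.low

/-- The morphism induced by `f` on `U`-homology objects in `T_c`. -/
structure CHomologyMapData (U : Set T) (n : ℤ) {X Y : T} (f : X ⟶ Y)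
    (dX : CHomologyData T U n X) (dY : CHomologyData T U n Y) where
  g : dX.t.low ⟶ dY.t.low
  hg : g ≫ dY.t.ι = dX.t.ι ≫ f
  h : dX.s.high ⟶ dY.s.high
  hh : dX.s.π ≫ h = g ≫ dY.s.π

/-- The left aisle `U ⊆ T_c` is non-degenerate: a morphism `f` of `T_c` is
invertible if and only if `H^p(f)` is invertible for all `p : ℤ`. -/
def UNondegenerate (U : Set T) : Prop :=
  ∀ ⦃X Y : T⦄, IsCompactObj T X → IsCompactObj T Y → ∀ f : X ⟶ Y,
    (IsIso f ↔ ∀ (p : ℤ) (dX : CHomologyData T U p X) (dY : CHomologyData T U p Y)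
      (m : CHomologyMapData T U p f dX dY), IsIso m.h)

/-- Condition (†): for each compact `X` there is an integer `N` such that
`Hom(X, S^N U') = 0` for every `U' ∈ U`. -/
def CondDagger (U : Set T) : Prop :=
  ∀ X : T, IsCompactObj T X → ∃ N : ℤ, ∀ U' ∈ U, ∀ f : X ⟶ U'⟦N⟧, f = 0

section Helpers

variable {T}

set_option linter.unusedSectionVars false

/-- Projection of a coproduct onto a summand. -/
noncomputable def cpi {I : Type v} {Y : I → T} {c : Cofan Y} (hc : IsColimit c) (i : I) :
    c.pt ⟶ Y i := by
  classical
  exact Cofan.IsColimit.desc hc (fun k => if h : k = i then eqToHom (by rw [h]) else 0)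

lemma inj_cpi_self {I : Type v} {Y : I → T} {c : Cofan Y} (hc : IsColimit c) (i : I) :
    c.inj i ≫ cpi hc i = 𝟙 _ := by
  simp [cpi, Cofan.IsColimit.fac]

lemma inj_cpi_ne {I : Type v} {Y : I → T} {c : Cofan Y} (hc : IsColimit c) {i j : I}
    (h : i ≠ j) : c.inj i ≫ cpi hc j = 0 := by
  simp [cpi, Cofan.IsColimit.fac, h]

/-- The idempotent of a coproduct attached to a finite subset of the index set. -/
noncomputable def ce {I : Type v} {Y : I → T} {c : Cofan Y} (hc : IsColimit c) (s : Finset I) :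
    c.pt ⟶ c.pt := ∑ i ∈ s, cpi hc i ≫ c.inj i

lemma inj_ce {I : Type v} {Y : I → T} {c : Cofan Y} (hc : IsColimit c) (s : Finset I)
    {i : I} (hi : i ∈ s) : c.inj i ≫ ce hc s = c.inj i := by
  rw [ce, Preadditive.comp_sum, Finset.sum_eq_single i]
  · rw [← Category.assoc, inj_cpi_self, Category.id_comp]
  · intro b _ hb
    rw [← Category.assoc, inj_cpi_ne hc hb.symm, zero_comp]
  · intro h; exact absurd hi h

lemma ce_ce {I : Type v} {Y : I → T} {c : Cofan Y} (hc : IsColimit c) {s t : Finset I}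
    (h : s ⊆ t) : ce hc s ≫ ce hc t = ce hc s := by
  have h1 : ce hc s ≫ ce hc t = (∑ i ∈ s, cpi hc i ≫ c.inj i) ≫ ce hc t := rfl
  rw [h1, Preadditive.sum_comp]
  refine Finset.sum_congr rfl fun i hi => ?_
  rw [Category.assoc, inj_ce hc t (h hi)]

/-- The morphism factors through a finite subcoproduct. -/
def FinFac {I : Type v} {Y : I → T} {c : Cofan Y} (hc : IsColimit c) {C : T} (f : C ⟶ c.pt) :
    Prop := ∃ s : Finset I, f ≫ ce hc s = f

lemma FinFac.comp {I : Type v} {Y : I → T} {c : Cofan Y} {hc : IsColimit c} {C D : T}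
    {f : C ⟶ c.pt} (h : FinFac hc f) (g : D ⟶ C) : FinFac hc (g ≫ f) := by
  obtain ⟨s, hs⟩ := h
  exact ⟨s, by rw [Category.assoc, hs]⟩

lemma finFac_inj {I : Type v} {Y : I → T} {c : Cofan Y} (hc : IsColimit c) (i : I) :
    FinFac hc (c.inj i) := ⟨{i}, inj_ce hc _ (by simp)⟩

lemma FinFac.add {I : Type v} {Y : I → T} {c : Cofan Y} {hc : IsColimit c} {C : T}
    {f g : C ⟶ c.pt} (hf : FinFac hc f) (hg : FinFac hc g) : FinFac hc (f + g) := by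
  classical
  obtain ⟨s, hs⟩ := hf
  obtain ⟨t, ht⟩ := hg
  refine ⟨s ∪ t, ?_⟩
  have h1 : f ≫ ce hc (s ∪ t) = f := by
    rw [← hs, Category.assoc, ce_ce hc Finset.subset_union_left]
  have h2 : g ≫ ce hc (s ∪ t) = g := by
    rw [← ht, Category.assoc, ce_ce hc Finset.subset_union_right]
  rw [Preadditive.add_comp, h1, h2]

lemma finFac_ce {I : Type v} {Y : I → T} {c : Cofan Y} (hc : IsColimit c) (s : Finset I) :
    FinFac hc (ce hc s) := ⟨s, ce_ce hc subset_rfl⟩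

/-- Elementary form of compactness. -/
def Cpt (C : T) : Prop :=
  ∀ (I : Type v) (Y : I → T) (c : Cofan Y) (hc : IsColimit c) (f : C ⟶ c.pt), FinFac hc f

lemma cpt_of_isCompactObj {C : T} (hC : IsCompactObj T C) : Cpt C := by
  intro I Y c hc f
  have := hC I
  let F := preadditiveCoyoneda.obj (Opposite.op C)
  have hF : IsColimit (F.mapCocone c) := isColimitOfPreserves F hc
  let H : AddSubgroup (C ⟶ c.pt) :=
    { carrier := {g | FinFac hc g}
      zero_mem' := ⟨∅, by simp⟩
      add_mem' := fun ha hb => ha.add hb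
      neg_mem' := by
        rintro a ⟨s, hs⟩
        exact ⟨s, by rw [Preadditive.neg_comp, hs]⟩ }
  let q : F.obj c.pt ⟶ AddCommGrpCat.of ((C ⟶ c.pt) ⧸ H) :=
    AddCommGrpCat.ofHom (QuotientAddGroup.mk' H)
  have hq : q = 0 := by
    apply hF.hom_ext
    rintro ⟨i⟩
    ext (g : C ⟶ Y i)
    change (QuotientAddGroup.mk' H) (g ≫ c.inj i) = 0
    rw [QuotientAddGroup.mk'_apply, QuotientAddGroup.eq_zero_iff]
    exact (finFac_inj hc i).comp g
  have : (QuotientAddGroup.mk' H) f = 0 := by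
    change q.hom f = 0
    rw [hq]; rfl
  rwa [QuotientAddGroup.mk'_apply, QuotientAddGroup.eq_zero_iff] at this

lemma Cpt.ext {Tr : Triangle T} (hT : Tr ∈ distTriang T) (h₁ : Cpt Tr.obj₁) (h₃ : Cpt Tr.obj₃) :
    Cpt Tr.obj₂ := by
  intro I Y c hc f
  obtain ⟨s, hs⟩ := h₁ I Y c hc (Tr.mor₁ ≫ f)
  obtain ⟨h, hh⟩ := Tr.yoneda_exact₂ hT (f - f ≫ ce hc s) (by
    rw [Preadditive.comp_sub, ← Category.assoc, hs, sub_self])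
  have := ((h₃ I Y c hc h).comp Tr.mor₂).add ((finFac_ce hc s).comp f)
  rwa [← hh, sub_add_cancel] at this

lemma Cpt.shift {C : T} (hC : Cpt C) (n : ℤ) : Cpt (C⟦n⟧) := by
  intro I Y c hc f
  let G := shiftFunctor T (-n)
  let c' : Cofan (fun i => (Y i)⟦-n⟧) := Cofan.mk (c.pt⟦-n⟧) (fun i => (c.inj i)⟦-n⟧')
  have hc' : IsColimit c' := isColimitCofanMkObjOfIsColimit G Y _ 
    (IsColimit.ofIsoColimit hc (Cofan.ext (Iso.refl _) (by intro i; simp)))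
  have hpi : ∀ i, cpi hc' i = (cpi hc i)⟦-n⟧' := by
    intro i
    apply Cofan.IsColimit.hom_ext hc'
    intro j
    have : c'.inj j = (c.inj j)⟦-n⟧' := rfl
    by_cases hij : j = i
    · subst hij
      rw [inj_cpi_self, this, ← Functor.map_comp, inj_cpi_self]; simp
    · rw [inj_cpi_ne hc' hij, this, ← Functor.map_comp, inj_cpi_ne hc hij]; simp
  have hce : ∀ s, ce hc' s = (ce hc s)⟦-n⟧' := by
    intro s
    rw [ce, ce, Functor.map_sum]
    apply Finset.sum_congr rfl
    intro i _
    rw [hpi, Functor.map_comp]; rfl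
  let u : C ≅ (C⟦n⟧)⟦-n⟧ := (shiftShiftNeg C n).symm
  obtain ⟨s, hs⟩ := hC I _ c' hc' (u.hom ≫ f⟦-n⟧')
  refine ⟨s, ?_⟩
  apply (shiftFunctor T (-n)).map_injective
  rw [hce, Category.assoc] at hs
  have := (cancel_epi _).1 hs
  rw [← this, Functor.map_comp]

lemma Cpt.of_iso {C D : T} (e : C ≅ D) (hC : Cpt C) : Cpt D := by
  intro I Y c hc f
  have := (hC I Y c hc (e.hom ≫ f)).comp e.inv
  simpa using this

lemma Cpt.zero {C : T} (hC : IsZero C) : Cpt C := by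
  intro I Y c hc f
  exact ⟨∅, hC.eq_of_src _ _⟩

lemma Cpt.fib {Tr : Triangle T} (hT : Tr ∈ distTriang T) (h₂ : Cpt Tr.obj₂) (h₃ : Cpt Tr.obj₃) :
    Cpt Tr.obj₁ :=
  Cpt.ext (inv_rot_of_distTriang _ hT) (h₃.shift (-1)) h₂

section Tower

variable (Y : ℕ → T) (i : ∀ n, Y n ⟶ Y (n + 1))
  (c : Cofan (fun k : ULift.{v} ℕ => Y k.down)) (hc : IsColimit c)

/-- The shift endomorphism of the coproduct of a sequence. -/
noncomputable def csh : c.pt ⟶ c.pt :=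
  Cofan.IsColimit.desc hc (fun k => i k.down ≫ c.inj ⟨k.down + 1⟩)

lemma inj_csh (n : ℕ) : c.inj ⟨n⟩ ≫ csh Y i c hc = i n ≫ c.inj ⟨n + 1⟩ := by
  rw [csh, Cofan.IsColimit.fac]

lemma csh_cpi_zero : csh Y i c hc ≫ cpi hc ⟨0⟩ = 0 := by
  apply Cofan.IsColimit.hom_ext hc
  rintro ⟨k⟩
  rw [← Category.assoc, inj_csh, Category.assoc, inj_cpi_ne hc (by simp)]
  simp

lemma csh_cpi_succ (n : ℕ) : csh Y i c hc ≫ cpi hc ⟨n + 1⟩ = cpi hc ⟨n⟩ ≫ i n := by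
  apply Cofan.IsColimit.hom_ext hc
  rintro ⟨k⟩
  rw [← Category.assoc, inj_csh, Category.assoc]
  by_cases h : k = n
  · subst h
    rw [inj_cpi_self, ← Category.assoc, inj_cpi_self, Category.comp_id, Category.id_comp]
  · rw [inj_cpi_ne hc (by simpa using h), ← Category.assoc, inj_cpi_ne hc (by simpa using h)]
    simp

lemma eq_zero_of_comp_one_sub {C : T} (hC : Cpt C) (g : C ⟶ c.pt)
    (hg : g ≫ (𝟙 _ - csh Y i c hc) = 0) : g = 0 := by
  have hg' : g = g ≫ csh Y i c hc := by
    rw [Preadditive.comp_sub, Category.comp_id] at hg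
    exact sub_eq_zero.1 hg
  have key : ∀ n : ℕ, g ≫ cpi hc ⟨n⟩ = 0 := by
    intro n
    induction n with
    | zero => rw [hg', Category.assoc, csh_cpi_zero, comp_zero]
    | succ n ih =>
      rw [hg', Category.assoc, csh_cpi_succ, ← Category.assoc, ih, zero_comp]
  obtain ⟨s, hs⟩ := hC _ _ c hc g
  rw [← hs, ce, Preadditive.comp_sum]
  apply Finset.sum_eq_zero
  rintro ⟨n⟩ _
  rw [← Category.assoc, key, zero_comp]

lemma eq_zero_of_comp_one_sub_shift {C : T} (hC : Cpt C) (g : C ⟶ c.pt⟦(1 : ℤ)⟧)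
    (hg : g ≫ (𝟙 _ - csh Y i c hc)⟦(1 : ℤ)⟧' = 0) : g = 0 := by
  have h := eq_zero_of_comp_one_sub Y i c hc (hC.shift (-1))
    (g⟦(-1 : ℤ)⟧' ≫ (shiftShiftNeg c.pt (1 : ℤ)).hom) (by
      have hn : (shiftShiftNeg c.pt (1 : ℤ)).hom ≫ (𝟙 _ - csh Y i c hc) =
          ((𝟙 _ - csh Y i c hc)⟦(1 : ℤ)⟧')⟦(-1 : ℤ)⟧' ≫ (shiftShiftNeg c.pt (1 : ℤ)).hom := by
        exact ((shiftFunctorCompIsoId T (1 : ℤ) (-1) (by simp)).hom.naturality _).symm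
      rw [Category.assoc, hn, ← Category.assoc, ← Functor.map_comp, hg, Functor.map_zero]
      exact zero_comp)
  apply (shiftFunctor T (-1 : ℤ)).map_injective
  rw [Functor.map_zero]
  rw [← cancel_mono (shiftShiftNeg c.pt (1 : ℤ)).hom, h, zero_comp]

lemma hocolim_factor {Z : T} (a : c.pt ⟶ Z) (d : Z ⟶ c.pt⟦(1 : ℤ)⟧)
    (hT : Triangle.mk (𝟙 _ - csh Y i c hc) a d ∈ distTriang T) {C : T} (hC : Cpt C)
    (f : C ⟶ Z) : ∃ (n : ℕ) (g : C ⟶ Y n), f = g ≫ c.inj ⟨n⟩ ≫ a := by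
  have hz : (𝟙 _ - csh Y i c hc) ≫ a = 0 := comp_distTriang_mor_zero₁₂ _ hT
  have hstep : ∀ n, c.inj ⟨n⟩ ≫ a = i n ≫ c.inj ⟨n + 1⟩ ≫ a := by
    intro n
    rw [Preadditive.sub_comp, Category.id_comp, sub_eq_zero] at hz
    conv_lhs => rw [hz]
    rw [← Category.assoc, inj_csh, Category.assoc]
  have hmono : ∀ (n m : ℕ), n ≤ m → ∀ g : C ⟶ Y n, ∃ g' : C ⟶ Y m,
      g ≫ c.inj ⟨n⟩ ≫ a = g' ≫ c.inj ⟨m⟩ ≫ a := by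
    intro n m hnm
    induction m, hnm using Nat.le_induction with
    | base => exact fun g => ⟨g, rfl⟩
    | succ m _ ih =>
      intro g
      obtain ⟨g', hg'⟩ := ih g
      exact ⟨g' ≫ i m, by rw [hg', hstep m, Category.assoc]⟩
  have hd : f ≫ d = 0 := by
    apply eq_zero_of_comp_one_sub_shift Y i c hc hC
    have : d ≫ (𝟙 _ - csh Y i c hc)⟦(1 : ℤ)⟧' = 0 := comp_distTriang_mor_zero₃₁ _ hT
    rw [Category.assoc, this, comp_zero]
  obtain ⟨h, hh⟩ := Triangle.coyoneda_exact₃ _ hT f hd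
  change C ⟶ c.pt at h
  change f = h ≫ a at hh
  obtain ⟨s, hs⟩ := hC _ _ c hc h
  rw [hh, ← hs, ce, Preadditive.comp_sum, Preadditive.sum_comp]
  clear hs
  classical
  induction s using Finset.induction_on with
  | empty => exact ⟨0, 0, by simp⟩
  | insert b s hb ih =>
    rw [Finset.sum_insert hb]
    obtain ⟨n, g, hg⟩ := ih
    obtain ⟨g1, hg1⟩ := hmono n (max n b.down) (le_max_left _ _) g
    obtain ⟨g2, hg2⟩ := hmono b.down (max n b.down) (le_max_right _ _) (h ≫ cpi hc b)
    refine ⟨max n b.down, g2 + g1, ?_⟩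
    rw [hg, hg1, Preadditive.add_comp, ← hg2]
    simp

end Tower

lemma exists_step {J : Type v} (W : J → T) {X Y : T} (ε : Y ⟶ X) :
    ∃ (Y' : T) (i : Y ⟶ Y') (ε' : Y' ⟶ X) (I : Type v) (k : I → J)
      (p : Y' ⟶ ∐ (fun x => W (k x))) (q : (∐ (fun x => W (k x))) ⟶ Y⟦(1 : ℤ)⟧),
      Triangle.mk i p q ∈ distTriang T ∧ i ≫ ε' = ε ∧
      ∀ (j : J) (f : W j ⟶ Y⟦(1 : ℤ)⟧), f ≫ ε⟦(1 : ℤ)⟧' = 0 → f ≫ i⟦(1 : ℤ)⟧' = 0 := by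
  let I : Type v := Σ j : J, {f : W j ⟶ Y⟦(1 : ℤ)⟧ // f ≫ ε⟦(1 : ℤ)⟧' = 0}
  let k : I → J := Sigma.fst
  let q : (∐ (fun x => W (k x))) ⟶ Y⟦(1 : ℤ)⟧ := Sigma.desc (fun x => x.2.1)
  obtain ⟨Y', i, p, hT⟩ := distinguished_cocone_triangle₂ q
  have hq : q ≫ ε⟦(1 : ℤ)⟧' = 0 := by
    apply Sigma.hom_ext
    intro x
    rw [← Category.assoc, Sigma.ι_desc, x.2.2, comp_zero]
  obtain ⟨g, hg⟩ := Triangle.yoneda_exact₃ _ (rot_of_distTriang _ hT) (ε⟦(1 : ℤ)⟧') hq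
  change Y'⟦(1 : ℤ)⟧ ⟶ X⟦(1 : ℤ)⟧ at g
  change ε⟦(1 : ℤ)⟧' = (-i⟦(1 : ℤ)⟧') ≫ g at hg
  obtain ⟨g', hg'⟩ := (shiftFunctor T (1 : ℤ)).map_surjective g
  refine ⟨Y', i, -g', I, k, p, q, hT, ?_, ?_⟩
  · apply (shiftFunctor T (1 : ℤ)).map_injective
    rw [hg, Functor.map_comp, Functor.map_neg, hg']
    simp
  · intro j f hf
    have h1 : f = Sigma.ι (fun x => W (k x)) ⟨j, f, hf⟩ ≫ q := by
      rw [Sigma.ι_desc]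
    have h2 : q ≫ i⟦(1 : ℤ)⟧' = 0 := comp_distTriang_mor_zero₃₁ _ hT
    rw [h1, Category.assoc, h2, comp_zero]

lemma exists_seq {α : Sort*} (R : α → α → Prop) (h : ∀ a, ∃ b, R a b) (a : α) (P : α → Prop)
    (ha : P a) : ∃ s : ℕ → α, P (s 0) ∧ ∀ n, R (s n) (s (n + 1)) := by
  choose F hF using h
  exact ⟨fun n => Nat.rec a (fun _ x => F x) n, ha, fun n => hF _⟩

lemma exists_tower {J : Type v} (W : J → T) (hW : ∀ j, Cpt (W j)) (X : T) :
    ∃ (Y : ℕ → T) (i : ∀ n, Y n ⟶ Y (n + 1)) (Z : T) (φ : (∐ (fun k : ULift.{v} ℕ => Y k.down)) ⟶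
        (∐ (fun k : ULift.{v} ℕ => Y k.down)))
      (a : (∐ (fun k : ULift.{v} ℕ => Y k.down)) ⟶ Z)
      (d : Z ⟶ (∐ (fun k : ULift.{v} ℕ => Y k.down))⟦(1 : ℤ)⟧) (e : Z ⟶ X),
      (∃ (I : Type v) (k : I → J), Nonempty (Y 0 ≅ ∐ (fun x => W (k x)))) ∧
      (∀ n, ∃ (I : Type v) (k : I → J) (p : Y (n + 1) ⟶ ∐ (fun x => W (k x)))
        (q : (∐ (fun x => W (k x))) ⟶ (Y n)⟦(1 : ℤ)⟧), Triangle.mk (i n) p q ∈ distTriang T) ∧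
      Triangle.mk φ a d ∈ distTriang T ∧
      (∀ (C : T), Cpt C → ∀ f : C ⟶ Z, ∃ (n : ℕ) (g : C ⟶ Y n) (h : Y n ⟶ Z), f = g ≫ h) ∧
      (∀ (Q : T) (b : X ⟶ Q) (b' : Q ⟶ Z⟦(1 : ℤ)⟧), Triangle.mk e b b' ∈ distTriang T →
        ∀ j (f : W j ⟶ Q), f = 0) := by
  let R : (Σ Y : T, (Y ⟶ X)) → (Σ Y : T, (Y ⟶ X)) → Prop := fun A B =>
    ∃ (i : A.1 ⟶ B.1) (I : Type v) (k : I → J)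
      (p : B.1 ⟶ ∐ (fun x => W (k x))) (q : (∐ (fun x => W (k x))) ⟶ A.1⟦(1 : ℤ)⟧),
      Triangle.mk i p q ∈ distTriang T ∧ i ≫ B.2 = A.2 ∧
      ∀ (j : J) (f : W j ⟶ A.1⟦(1 : ℤ)⟧), f ≫ A.2⟦(1 : ℤ)⟧' = 0 → f ≫ i⟦(1 : ℤ)⟧' = 0
  let I0 : Type v := Σ j : J, (W j ⟶ X)
  let A0 : Σ Y : T, (Y ⟶ X) := ⟨∐ (fun x : I0 => W x.1), Sigma.desc (fun x => x.2)⟩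
  obtain ⟨S, hS0, hS⟩ := exists_seq R (fun A => by
    obtain ⟨Y', i, ε', I, k, p, q, h⟩ := exists_step W A.2
    exact ⟨⟨Y', ε'⟩, i, I, k, p, q, h⟩) A0
    (fun A => (∃ (I : Type v) (k : I → J), Nonempty (A.1 ≅ ∐ (fun x => W (k x)))) ∧
      ∀ j (f : W j ⟶ X), ∃ g : W j ⟶ A.1, g ≫ A.2 = f)
    ⟨⟨I0, Sigma.fst, ⟨Iso.refl _⟩⟩, fun j f =>
      ⟨Sigma.ι (fun x : I0 => W x.1) ⟨j, f⟩, by simp [A0]⟩⟩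
  choose i hi using hS
  let Y : ℕ → T := fun n => (S n).1
  let c : Cofan (fun k : ULift.{v} ℕ => Y k.down) := Cofan.mk _ (Sigma.ι _)
  let hc : IsColimit c := coproductIsCoproduct _
  obtain ⟨Z, a, d, hT⟩ := distinguished_cocone_triangle (𝟙 _ - csh Y i c hc)
  let e0 : c.pt ⟶ X := Cofan.IsColimit.desc hc (fun k => (S k.down).2)
  have he0 : (𝟙 _ - csh Y i c hc) ≫ e0 = 0 := by
    apply Cofan.IsColimit.hom_ext hc
    rintro ⟨n⟩
    obtain ⟨I, k, p, q, h1, h2, h3⟩ := hi n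
    rw [Preadditive.sub_comp, Preadditive.comp_sub, ← Category.assoc (c.inj _) (csh Y i c hc),
      inj_csh, Category.id_comp, Category.assoc, Cofan.IsColimit.fac, Cofan.IsColimit.fac, h2]
    simp
  obtain ⟨e, he⟩ := Triangle.yoneda_exact₂ _ hT e0 he0
  change Z ⟶ X at e
  change e0 = a ≫ e at he
  have hen : ∀ n, c.inj ⟨n⟩ ≫ a ≫ e = (S n).2 := by
    intro n
    rw [← he, Cofan.IsColimit.fac]
  have hz : (𝟙 _ - csh Y i c hc) ≫ a = 0 := comp_distTriang_mor_zero₁₂ _ hT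
  have hstep : ∀ n, c.inj ⟨n⟩ ≫ a = i n ≫ c.inj ⟨n + 1⟩ ≫ a := by
    intro n
    rw [Preadditive.sub_comp, Category.id_comp, sub_eq_zero] at hz
    conv_lhs => rw [hz]
    rw [← Category.assoc, inj_csh, Category.assoc]
  refine ⟨Y, i, Z, _, a, d, e, hS0.1, ?_, hT, ?_, ?_⟩
  · intro n
    obtain ⟨I, k, p, q, h1, h2, h3⟩ := hi n
    exact ⟨I, k, p, q, h1⟩
  · intro C hC f
    obtain ⟨n, g, hg⟩ := hocolim_factor Y i c hc a d hT hC f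
    exact ⟨n, g, _, hg⟩
  · intro Q b b' hQ j f
    have hinj : ∀ f : W j ⟶ Z⟦(1 : ℤ)⟧, f ≫ e⟦(1 : ℤ)⟧' = 0 → f = 0 := by
      intro f hf
      let u := shiftNegShift (W j) (1 : ℤ)
      obtain ⟨f', hf'⟩ := (shiftFunctor T (1 : ℤ)).map_surjective (u.hom ≫ f)
      obtain ⟨n, g, hg⟩ := hocolim_factor Y i c hc a d hT ((hW j).shift (-1)) f'
      obtain ⟨I, k, p, q, h1, h2, h3⟩ := hi n
      have h4 : f = (u.inv ≫ g⟦(1 : ℤ)⟧') ≫ (c.inj ⟨n⟩ ≫ a)⟦(1 : ℤ)⟧' := by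
        rw [Category.assoc, ← Functor.map_comp, ← hg, hf', Iso.inv_hom_id_assoc]
      have h5 := h3 j (u.inv ≫ g⟦(1 : ℤ)⟧') (by
        rw [← hen n, ← Category.assoc (c.inj _), Functor.map_comp, ← Category.assoc, ← h4, hf])
      rw [h4, hstep n, Functor.map_comp, ← Category.assoc, h5, zero_comp]
    have hb' : f ≫ b' = 0 := by
      apply hinj
      have : b' ≫ e⟦(1 : ℤ)⟧' = 0 := comp_distTriang_mor_zero₃₁ _ hQ
      rw [Category.assoc, this, comp_zero]
    obtain ⟨g, hg⟩ := Triangle.coyoneda_exact₃ _ hQ f hb'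
    change W j ⟶ X at g
    change f = g ≫ b at hg
    obtain ⟨g', hg'⟩ := hS0.2 j g
    have : e ≫ b = 0 := comp_distTriang_mor_zero₁₂ _ hQ
    rw [hg, ← hg', ← hen 0]
    simp only [Category.assoc, this, comp_zero]

open ZeroObject

/-- Objects built from the family `W` by finitely many extensions. -/
inductive FB {J : Type v} (W : J → T) : T → Prop
  | of (j : J) : FB W (W j)
  | zero (X : T) (hX : IsZero X) : FB W X
  | ext (Tr : Triangle T) (hT : Tr ∈ distTriang T) (h₁ : FB W Tr.obj₁) (h₃ : FB W Tr.obj₃) :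
      FB W Tr.obj₂

lemma FB.cpt {J : Type v} {W : J → T} (hW : ∀ j, Cpt (W j)) {X : T} (h : FB W X) : Cpt X := by
  induction h with
  | of j => exact hW j
  | zero X hX => exact Cpt.zero hX
  | ext Tr hT _ _ ih₁ ih₃ => exact Cpt.ext hT ih₁ ih₃

/-- The morphism factors through an object of `FB W`. -/
def Fac {J : Type v} (W : J → T) {A B : T} (f : A ⟶ B) : Prop :=
  ∃ (F : T) (_ : FB W F) (u : A ⟶ F) (w : F ⟶ B), f = u ≫ w

lemma Fac.add {J : Type v} {W : J → T} {A B : T} {f g : A ⟶ B} (hf : Fac W f) (hg : Fac W g) :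
    Fac W (f + g) := by
  obtain ⟨F, hF, u, w, rfl⟩ := hf
  obtain ⟨F', hF', u', w', rfl⟩ := hg
  refine ⟨F ⊞ F', FB.ext _ (binaryBiproductTriangle_distinguished F F') hF hF',
    biprod.lift u u', biprod.desc w w', by simp⟩

lemma Fac.comp {J : Type v} {W : J → T} {A B C : T} {f : A ⟶ B} (hf : Fac W f) (g : B ⟶ C) :
    Fac W (f ≫ g) := by
  obtain ⟨F, hF, u, w, rfl⟩ := hf
  exact ⟨F, hF, u, w ≫ g, by simp⟩

lemma fac_zero {J : Type v} (W : J → T) (A B : T) : Fac W (0 : A ⟶ B) :=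
  ⟨0, FB.zero _ (isZero_zero T), 0, 0, by simp⟩

lemma fac_coprod {J : Type v} (W : J → T) {I : Type v} (k : I → J) {C : T} (hC : Cpt C)
    (f : C ⟶ ∐ (fun x => W (k x))) : Fac W f := by
  obtain ⟨s, hs⟩ := hC _ _ _ (coproductIsCoproduct (fun x => W (k x))) f
  rw [← hs, ce, Preadditive.comp_sum]
  clear hs
  classical
  induction s using Finset.induction_on with
  | empty => exact fac_zero _ _ _
  | insert b s hb ih =>
    rw [Finset.sum_insert hb]
    refine Fac.add ⟨W (k b), FB.of _, _, _, (Category.assoc _ _ _).symm⟩ ih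

lemma fac_step {J : Type v} (W : J → T) (hW : ∀ j, Cpt (W j)) {I : Type v} (k : I → J)
    {Y Y' : T} (i : Y ⟶ Y') (p : Y' ⟶ ∐ (fun x => W (k x)))
    (q : (∐ (fun x => W (k x))) ⟶ Y⟦(1 : ℤ)⟧) (hT : Triangle.mk i p q ∈ distTriang T)
    (ih : ∀ C, Cpt C → ∀ f : C ⟶ Y, Fac W f) {C : T} (hC : Cpt C) (f : C ⟶ Y') : Fac W f := by
  obtain ⟨F, hF, u, w, huw⟩ := fac_coprod W k hC (f ≫ p)
  obtain ⟨D, d, r, hD⟩ := distinguished_cocone_triangle₁ u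
  have hDc : Cpt D := Cpt.fib hD hC (hF.cpt hW)
  obtain ⟨m, hm1, hm2⟩ := complete_distinguished_triangle_morphism₁ _ _ hD hT f w huw.symm
  change D ⟶ Y at m
  change d ≫ f = m ≫ i at hm1
  change r ≫ m⟦(1 : ℤ)⟧' = w ≫ q at hm2
  obtain ⟨K, hK, m1, m2, hm⟩ := ih D hDc m
  obtain ⟨E, κ, l, hE⟩ := distinguished_cocone_triangle₂ (r ≫ m1⟦(1 : ℤ)⟧')
  have hEF : FB W E := FB.ext _ hE hK hF
  obtain ⟨x, hx1, hx2⟩ := complete_distinguished_triangle_morphism₂ _ _ hD hE m1 (𝟙 F)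
    (by exact (Category.id_comp _).symm)
  obtain ⟨y, hy1, hy2⟩ := complete_distinguished_triangle_morphism₂ _ _ hE hT m2 w
    (by
      change (r ≫ m1⟦(1 : ℤ)⟧') ≫ m2⟦(1 : ℤ)⟧' = w ≫ q
      rw [Category.assoc, ← Functor.map_comp, ← hm, hm2])
  change C ⟶ E at x
  change E ⟶ Y' at y
  change u ≫ 𝟙 F = x ≫ l at hx2
  change l ≫ w = y ≫ p at hy2
  obtain ⟨b, hb⟩ := Triangle.coyoneda_exact₂ _ hT (f - x ≫ y) (by
    change (f - x ≫ y) ≫ p = 0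
    rw [Preadditive.sub_comp, Category.assoc, ← hy2, ← Category.assoc, ← hx2, Category.comp_id,
      huw, sub_self])
  change C ⟶ Y at b
  change f - x ≫ y = b ≫ i at hb
  have h1 : Fac W (x ≫ y) := ⟨E, hEF, x, y, rfl⟩
  have h2 := ((ih C hC b).comp i).add h1
  rwa [← hb, sub_add_cancel] at h2

/-- A property of objects is essentially small. -/
def EssSm (P : T → Prop) : Prop :=
  ∃ (J : Type v) (W : J → T), ∀ X, P X → ∃ j, Nonempty (X ≅ W j)

/-- The middle term of an extension. -/
noncomputable def mid {A B : T} (h : B ⟶ A⟦(1 : ℤ)⟧) : T :=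
  (distinguished_cocone_triangle₂ h).choose

lemma iso_mid (Tr : Triangle T) (hT : Tr ∈ distTriang T) {A B : T} (e₁ : Tr.obj₁ ≅ A)
    (e₃ : Tr.obj₃ ≅ B) : Nonempty (Tr.obj₂ ≅ mid (e₃.inv ≫ Tr.mor₃ ≫ e₁.hom⟦(1 : ℤ)⟧')) := by
  obtain ⟨i, p, h⟩ := (distinguished_cocone_triangle₂
    (e₃.inv ≫ Tr.mor₃ ≫ e₁.hom⟦(1 : ℤ)⟧')).choose_spec
  exact ⟨Triangle.π₂.mapIso (isoTriangleOfIso₁₃ _ _ hT h e₁ e₃ (by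
    exact (Iso.hom_inv_id_assoc e₃ _).symm))⟩

/-- Levels of the closure under extensions. -/
noncomputable def lev {J : Type v} (W : J → T) : ℕ → Σ J : Type v, (J → T)
  | 0 => ⟨J ⊕ PUnit, Sum.elim W (fun _ => 0)⟩
  | n + 1 => ⟨(lev W n).1 ⊕ (Σ (a b : (lev W n).1), ((lev W n).2 b ⟶ ((lev W n).2 a)⟦(1 : ℤ)⟧)),
      Sum.elim (lev W n).2 (fun x => mid x.2.2)⟩

lemma lev_mono {J : Type v} (W : J → T) {n m : ℕ} (h : n ≤ m) (a : (lev W n).1) :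
    ∃ b : (lev W m).1, (lev W m).2 b = (lev W n).2 a := by
  induction m, h using Nat.le_induction with
  | base => exact ⟨a, rfl⟩
  | succ m _ ih =>
    obtain ⟨b, hb⟩ := ih
    exact ⟨Sum.inl b, hb⟩

lemma essSm_FB {J : Type v} (W : J → T) : EssSm (FB W) := by
  refine ⟨Σ n, (lev W n).1, fun x => (lev W x.1).2 x.2, fun X hX => ?_⟩
  induction hX with
  | of j => exact ⟨⟨0, Sum.inl j⟩, ⟨Iso.refl _⟩⟩
  | zero X hX => exact ⟨⟨0, Sum.inr PUnit.unit⟩, ⟨hX.iso (isZero_zero T)⟩⟩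
  | ext Tr hT _ _ ih₁ ih₃ =>
    obtain ⟨⟨n, a⟩, ⟨e₁⟩⟩ := ih₁
    obtain ⟨⟨m, b⟩, ⟨e₃⟩⟩ := ih₃
    obtain ⟨a', ha⟩ := lev_mono W (le_max_left n m) a
    obtain ⟨b', hb⟩ := lev_mono W (le_max_right n m) b
    obtain ⟨e⟩ := iso_mid Tr hT (e₁ ≪≫ eqToIso ha.symm) (e₃ ≪≫ eqToIso hb.symm)
    exact ⟨⟨max n m + 1, Sum.inr ⟨a', b', _⟩⟩, ⟨e⟩⟩

lemma retract_iso {X X' F : T} {u : X ⟶ F} {w : F ⟶ X} {u' : X' ⟶ F} {w' : F ⟶ X'}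
    (h : u ≫ w = 𝟙 X) (h' : u' ≫ w' = 𝟙 X') (he : w' ≫ u' = w ≫ u) : Nonempty (X ≅ X') := by
  refine ⟨⟨u ≫ w', u' ≫ w, ?_, ?_⟩⟩
  · rw [Category.assoc, ← Category.assoc w', he, Category.assoc, h, Category.comp_id, h]
  · rw [Category.assoc, ← Category.assoc w, ← he, Category.assoc, h', Category.comp_id, h']

lemma essSm_retract {P : T → Prop} (hP : EssSm P) :
    EssSm (fun X => ∃ (F : T) (_ : P F) (u : X ⟶ F) (w : F ⟶ X), u ≫ w = 𝟙 X) := by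
  obtain ⟨J, W, hW⟩ := hP
  refine ⟨Σ j, {e : W j ⟶ W j // ∃ (X : T) (u : X ⟶ W j) (w : W j ⟶ X),
    u ≫ w = 𝟙 X ∧ w ≫ u = e}, fun x => x.2.2.choose, ?_⟩
  rintro X ⟨F, hF, u, w, huw⟩
  obtain ⟨j, ⟨e⟩⟩ := hW F hF
  have hh : ∃ (X' : T) (u' : X' ⟶ W j) (w' : W j ⟶ X'),
      u' ≫ w' = 𝟙 X' ∧ w' ≫ u' = (e.inv ≫ w) ≫ (u ≫ e.hom) :=
    ⟨X, u ≫ e.hom, e.inv ≫ w, by simp [huw], rfl⟩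
  refine ⟨⟨j, _, hh⟩, ?_⟩
  obtain ⟨u', w', h1, h2⟩ := hh.choose_spec
  exact retract_iso (by simp [huw]) h1 h2

lemma essSm_cpt (hT : CompactlyGenerated T) : EssSm (fun X : T => Cpt X) := by
  obtain ⟨G, hGs, hGc, hG⟩ := hT
  let J : Type v := Shrink.{v} G × ULift.{v} ℤ
  let W : J → T := fun x => (((equivShrink G).symm x.1 : G) : T)⟦x.2.down⟧
  have hW : ∀ j, Cpt (W j) := fun j => (cpt_of_isCompactObj (hGc _ (Subtype.prop _))).shift _
  obtain ⟨J', W', h'⟩ := essSm_retract (essSm_FB W)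
  refine ⟨J', W', fun X hX => h' X ?_⟩
  obtain ⟨Y, i, Z, φ, a, d, e, ⟨I, k, ⟨e0⟩⟩, hs, hφ, hfac, hz⟩ := exists_tower W hW X
  obtain ⟨Q, b, b', hQ⟩ := distinguished_cocone_triangle e
  have hQ0 : IsZero Q := by
    apply hG
    intro C hC n f
    have h1 := hz Q b b' hQ ⟨equivShrink G ⟨C, hC⟩, ⟨n⟩⟩
    have h2 : W ⟨equivShrink G ⟨C, hC⟩, ⟨n⟩⟩ = C⟦n⟧ := by
      change (((equivShrink G).symm (equivShrink G ⟨C, hC⟩) : G) : T)⟦n⟧ = C⟦n⟧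
      rw [Equiv.symm_apply_apply]
    rw [← cancel_epi (eqToHom h2), h1 (eqToHom h2 ≫ f), comp_zero]
  have : IsIso e := (Triangle.isZero₃_iff_isIso₁ _ hQ).1 hQ0
  have hall : ∀ n, ∀ C, Cpt C → ∀ f : C ⟶ Y n, Fac W f := by
    intro n
    induction n with
    | zero =>
      intro C hC f
      have := (fac_coprod W k hC (f ≫ e0.hom)).comp e0.inv
      simpa using this
    | succ n ih =>
      intro C hC f
      obtain ⟨I, k, p, q, hpq⟩ := hs n
      exact fac_step W hW k _ p q hpq ih hC f
  obtain ⟨n, g, h, hgh⟩ := hfac X hX (inv e)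
  obtain ⟨F, hF, u, w, hg⟩ := hall n X hX g
  refine ⟨F, hF, u, w ≫ h ≫ e, ?_⟩
  rw [← Category.assoc, ← hg, ← Category.assoc, ← hgh, IsIso.inv_hom_id]

lemma aisleGen_shift {U : Set T} (hU : ∀ X ∈ U, X⟦(1 : ℤ)⟧ ∈ U) {X : T} (hX : aisleGen T U X) :
    aisleGen T U (X⟦(1 : ℤ)⟧) := by
  induction hX with
  | of X hX => exact .of _ (hU X hX)
  | iso X Y e _ ih => exact .iso _ _ ((shiftFunctor T (1 : ℤ)).mapIso e) ih
  | coprod Y _ ih =>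
    exact .iso _ _ (PreservesCoproduct.iso (shiftFunctor T (1 : ℤ)) Y).symm (.coprod _ ih)
  | ext Tr hT _ _ ih₁ ih₃ =>
    exact .ext _ (Triangle.shift_distinguished _ hT 1) ih₁ ih₃

lemma aisleGen_orth {U : Set T} {Q : T} (hQ : ∀ X ∈ U, ∀ f : X ⟶ Q, f = 0) {X : T}
    (hX : aisleGen T U X) : ∀ f : X ⟶ Q, f = 0 := by
  induction hX with
  | of X hX => exact hQ X hX
  | iso X Y e _ ih =>
    intro f
    rw [← cancel_epi e.hom, ih (e.hom ≫ f), comp_zero]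
  | coprod Y _ ih =>
    intro f
    apply Sigma.hom_ext
    intro b
    rw [ih b (Sigma.ι Y b ≫ f), comp_zero]
  | ext Tr hT _ _ ih₁ ih₃ =>
    intro f
    obtain ⟨g, hg⟩ := Tr.yoneda_exact₂ hT f (ih₁ _)
    rw [hg, ih₃ g, comp_zero]

end Helpers

/-- Proposition A.1(a), existence part: `T_{≤0}` is stable under the suspension
functor and the inclusion `T_{≤0} ↪ T` admits a right adjoint; hence `T_{≤0}` is a
left aisle on `T`. -/
theorem stmt0 (hT : CompactlyGenerated T) (U : LeftAisle T (Compacts T)) :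
    (∀ X ∈ TLe0 T U.carrier, X⟦(1 : ℤ)⟧ ∈ TLe0 T U.carrier) ∧
    (∀ X : T, ∃ (X'' : T) (_ : X'' ∈ TLe0 T U.carrier) (ε : X'' ⟶ X),
      ∀ R ∈ TLe0 T U.carrier, Function.Bijective fun g : R ⟶ X'' => g ≫ ε) := by
  have hsh : ∀ X ∈ TLe0 T U.carrier, X⟦(1 : ℤ)⟧ ∈ TLe0 T U.carrier :=
    fun X hX => aisleGen_shift U.shift_mem hX
  refine ⟨hsh, fun X => ?_⟩
  obtain ⟨J', W', hW'⟩ := essSm_cpt hT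
  let J : Type v := {j : J' // ∃ X ∈ U.carrier, Nonempty (X ≅ W' j)}
  let W : J → T := fun j => j.2.choose
  have hWU : ∀ j, W j ∈ U.carrier := fun j => j.2.choose_spec.1
  have hWiso : ∀ X ∈ U.carrier, ∃ j, Nonempty (X ≅ W j) := by
    intro X hX
    obtain ⟨j, ⟨e⟩⟩ := hW' X (cpt_of_isCompactObj (U.subset hX))
    let j' : J := ⟨j, X, hX, ⟨e⟩⟩
    obtain ⟨e'⟩ := j'.2.choose_spec.2
    exact ⟨j', ⟨e ≪≫ e'.symm⟩⟩
  obtain ⟨Y, i, Z, φ, a, d, e, ⟨I, k, ⟨e0⟩⟩, hs, hφ, -, hz⟩ :=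
    exists_tower W (fun j => cpt_of_isCompactObj (U.subset (hWU j))) X
  have hcop : ∀ (I : Type v) (k : I → J), aisleGen T U.carrier (∐ (fun x => W (k x))) :=
    fun I k => .coprod _ fun x => .of _ (hWU _)
  have hY : ∀ n, aisleGen T U.carrier (Y n) := by
    intro n
    induction n with
    | zero => exact .iso _ _ e0.symm (hcop _ _)
    | succ n ih =>
      obtain ⟨I, k, p, q, hpq⟩ := hs n
      exact .ext _ hpq ih (hcop _ _)
  have hA : aisleGen T U.carrier (∐ (fun k : ULift.{v} ℕ => Y k.down)) :=
    .coprod _ fun k => hY k.down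
  have hZ : aisleGen T U.carrier Z := .ext _ (rot_of_distTriang _ hφ) hA (hsh _ hA)
  obtain ⟨Q, b, b', hQ⟩ := distinguished_cocone_triangle e
  have horth : ∀ R, aisleGen T U.carrier R → ∀ f : R ⟶ Q, f = 0 := by
    intro R hR
    refine aisleGen_orth ?_ hR
    intro X hX f
    obtain ⟨j, ⟨e1⟩⟩ := hWiso X hX
    rw [← cancel_epi e1.inv, hz Q b b' hQ j (e1.inv ≫ f), comp_zero]
  refine ⟨Z, hZ, e, fun R hR => ⟨?_, ?_⟩⟩
  · intro g₁ g₂ hg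
    have h0 : (g₁ - g₂) ≫ e = 0 := by
      rw [Preadditive.sub_comp]; exact sub_eq_zero.2 hg
    have h1 : (g₁ - g₂)⟦(1 : ℤ)⟧' ≫ e⟦(1 : ℤ)⟧' = 0 := by
      rw [← Functor.map_comp, h0, Functor.map_zero]
    obtain ⟨t, ht⟩ := Triangle.coyoneda_exact₁ _ hQ ((g₁ - g₂)⟦(1 : ℤ)⟧') h1
    have ht0 : (g₁ - g₂)⟦(1 : ℤ)⟧' = 0 := by
      rw [horth _ (hsh R hR) t] at ht
      exact ht.trans zero_comp
    exact sub_eq_zero.1 ((shiftFunctor T (1 : ℤ)).map_injective (by rw [ht0, Functor.map_zero]))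
  · intro f
    obtain ⟨g, hg⟩ := Triangle.coyoneda_exact₂ _ hQ f (horth R hR _)
    exact ⟨g, hg.symm⟩

end CYPaper
end

section
/- Assume condition (†): for each compact object X of T there is an integer N such that Hom_T(X, S^N U') = 0 for every U' ∈ U. Then ⋂_{n∈ℕ} T_{≤−n} = 0: any object X of T belonging to T_{≤−n} for every natural number n is zero. (Sub-claim established in the proof of Proposition A.1(b).) -/
/-!
Setting: `T` is a compactly generated triangulated category with suspension
functor `S = ⟦1⟧` admitting arbitrary (small) coproducts, `U ⊆ T_c` is a left
aisle in the full subcategory `T_c` of compact objects, and `T_{≤0}` is the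
smallest strictly full subcategory of `T` containing `U` and stable under
arbitrary coproducts and under extensions.
-/

namespace CYPaper

open CategoryTheory CategoryTheory.Limits CategoryTheory.Pretriangulated

universe v u

variable (T : Type u) [Category.{v} T] [HasZeroObject T] [Preadditive T]
  [HasShift T ℤ] [∀ n : ℤ, (shiftFunctor T n).Additive]
  [Pretriangulated T] [HasCoproducts.{v} T]

/-- Compactness kills maps into shifted coproducts. -/
theorem coprod_vanish (C : T) (hC : IsCompactObj T C) (M : ℤ) {I : Type v} (Y : I → T)
    (h : ∀ i, ∀ f : C ⟶ (Y i)⟦M⟧, f = 0) (f : C ⟶ (∐ Y)⟦M⟧) : f = 0 := by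
  haveI := hC I
  let F : T ⥤ AddCommGrpCat.{v} :=
    shiftFunctor T M ⋙ preadditiveCoyoneda.obj (Opposite.op C)
  haveI : PreservesColimitsOfShape (Discrete I) F := by
    dsimp only [F]; infer_instance
  have hc := isColimitOfPreserves F (colimit.isColimit (Discrete.functor Y))
  have h0 : 𝟙 (F.obj (∐ Y)) = 0 := by
    apply hc.hom_ext
    rintro ⟨i⟩
    ext (g : C ⟶ (Y i)⟦M⟧)
    have hg := h i g
    subst hg
    exact (map_zero _).trans (map_zero _).symm
  exact congrArg (fun t : F.obj (∐ Y) ⟶ F.obj (∐ Y) => t.hom f) h0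

theorem gen_vanish (U : Set T) (C : T) (hC : IsCompactObj T C) (M : ℤ)
    (h : ∀ Z ∈ U, ∀ f : C ⟶ Z⟦M⟧, f = 0) (Z : T) (hZ : aisleGen T U Z) :
    ∀ f : C ⟶ Z⟦M⟧, f = 0 := by
  induction hZ with
  | of X hX => exact h X hX
  | iso X Y e _ ih =>
    intro f
    have := ih (f ≫ (shiftFunctor T M).map e.inv)
    exact (cancel_mono ((shiftFunctor T M).map e.inv)).1 (by rw [this, zero_comp])
  | coprod Y _ ih => exact coprod_vanish T C hC M Y ih
  | ext Tr hTr _ _ ih1 ih3 =>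
    intro f
    have hd := Triangle.shift_distinguished Tr hTr M
    obtain ⟨g, hg⟩ := Triangle.coyoneda_exact₂ _ hd f (ih3 _)
    rw [hg, ih1 g]
    exact zero_comp

theorem iso_vanish {C X Y : T} (e : X ≅ Y) (h : ∀ f : C ⟶ X, f = 0) (f : C ⟶ Y) : f = 0 :=
  (cancel_mono e.inv).1 (by rw [h (f ≫ e.inv), zero_comp])

theorem up_vanish (U : Set T) (hs : ∀ X ∈ U, X⟦(1 : ℤ)⟧ ∈ U) (C : T) (N : ℤ)
    (h : ∀ Z ∈ U, ∀ f : C ⟶ Z⟦N⟧, f = 0) (k : ℕ) :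
    ∀ Z ∈ U, ∀ f : C ⟶ Z⟦N + (k : ℤ)⟧, f = 0 := by
  induction k with
  | zero =>
    have e : N + ((0 : ℕ) : ℤ) = N := by simp
    rw [e]
    exact h
  | succ k ih =>
    intro Z hZ
    exact iso_vanish T ((shiftFunctorAdd' T (1 : ℤ) (N + (k : ℤ)) (N + ((k + 1 : ℕ) : ℤ))
      (by push_cast; ring)).symm.app Z) (ih _ (hs Z hZ))

/-- Sub-claim in the proof of Proposition A.1(b): under condition (†),
`⋂_{n ∈ ℕ} T_{≤−n} = 0`: any object of `T` lying in `T_{≤−n}` for every natural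
number `n` is zero. -/
theorem stmt11 (hT : CompactlyGenerated T) (U : LeftAisle T (Compacts T))
    (hdag : CondDagger T U.carrier)
    (X : T) (hX : ∀ n : ℕ, X ∈ TLe T U.carrier (-(n : ℤ))) :
    IsZero X := by
  obtain ⟨G, _, hG, hgen⟩ := hT
  refine hgen X fun C hC m f => ?_
  obtain ⟨N, hN⟩ := hdag C (hG C hC)
  have hM := up_vanish T U.carrier U.shift_mem C N hN ((N + m).toNat - (N + m)).toNat
  have hz := gen_vanish T U.carrier C (hG C hC) _ hM _ (hX (N + m).toNat)
  have hz' : ∀ g : C ⟶ X⟦-m⟧, g = 0 :=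
    iso_vanish T ((shiftFunctorAdd' T _ _ (-m) (by omega)).symm.app X) hz
  have h1 := hz' ((shiftEquiv T m).toAdjunction.homEquiv C X f)
  apply ((shiftEquiv T m).toAdjunction.homEquiv C X).injective
  rw [h1]
  exact (hz' _).symm

end CYPaper
end
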